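/- Let m > n and K ≥ 0, suppose (ℝ^n, φ) satisfies the CD(−K, m) condition, and let u : (0,∞) × ℝ^n → ℝ be a smooth positive solution of the heat equation ∂ₜu = Lu. Then for all x, y ∈ ℝ^n and all 0 < τ < T, u(τ, x)/u(T, y) ≤ (T/τ)^{m/2} · exp{ (1/4) e^{2Kτ} (1 + 2K(T − τ)) |x − y|²/(T − τ) + (m/2)(e^{2KT} − e^{2Kτ}) }. (Euclidean case of the paper's Theorem 2.2, the integrated Harnack inequality obtained from the Hamilton differential Harnack inequality.) -/

import Mathlib

open scoped RealInnerProductSpace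

noncomputable section

/-- Hessian of `f` at `x`, evaluated at the pair of vectors `(v, w)`. -/
def hess (n : ℕ) (f : EuclideanSpace ℝ (Fin n) → ℝ) (x v w : EuclideanSpace ℝ (Fin n)) : ℝ :=
  fderiv ℝ (fun y => fderiv ℝ f y v) x w

/-- Laplacian `Δf = tr ∇²f`. -/
def lap (n : ℕ) (f : EuclideanSpace ℝ (Fin n) → ℝ) (x : EuclideanSpace ℝ (Fin n)) : ℝ :=
  ∑ i : Fin n, hess n f x (EuclideanSpace.single i 1) (EuclideanSpace.single i 1)

/-- Witten Laplacian `Lf = Δf − ⟨∇φ, ∇f⟩`. -/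
def witten (n : ℕ) (φ f : EuclideanSpace ℝ (Fin n) → ℝ) (x : EuclideanSpace ℝ (Fin n)) : ℝ :=
  lap n f x - ⟪gradient φ x, gradient f x⟫

/-- Squared Frobenius norm of the Hessian. -/
def hessNormSq (n : ℕ) (f : EuclideanSpace ℝ (Fin n) → ℝ) (x : EuclideanSpace ℝ (Fin n)) : ℝ :=
  ∑ i : Fin n, ∑ j : Fin n,
    (hess n f x (EuclideanSpace.single i 1) (EuclideanSpace.single j 1)) ^ 2

/-- The `CD(−K, m)` condition on Euclidean space `ℝⁿ`:
`∇²φ(v,v) − ⟨∇φ, v⟩²/(m−n) ≥ −K|v|²` at every point and for every vector. -/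
def CDcond (n : ℕ) (φ : EuclideanSpace ℝ (Fin n) → ℝ) (m K : ℝ) : Prop :=
  ∀ x v : EuclideanSpace ℝ (Fin n),
    hess n φ x v v - ⟪gradient φ x, v⟫ ^ 2 / (m - n) ≥ -K * ‖v‖ ^ 2


/-- Directional derivative of `F` in the fixed direction `v`, as a function of the point. -/
def dirD {V : Type*} [NormedAddCommGroup V] [NormedSpace ℝ V] (v : V) (F : V → ℝ) (p : V) : ℝ :=
  fderiv ℝ F p v

section DirectionalCalculus

variable {V : Type*} [NormedAddCommGroup V] [NormedSpace ℝ V] {Ω : Set V} {F G : V → ℝ} {p : V}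

lemma ContDiffOn.diffAt_of_isOpen (hΩ : IsOpen Ω) (hF : ContDiffOn ℝ (⊤ : ℕ∞) F Ω) (hp : p ∈ Ω) :
    DifferentiableAt ℝ F p :=
  (hF.contDiffAt (hΩ.mem_nhds hp)).differentiableAt (by simp)

lemma ContDiffOn.dirD (hΩ : IsOpen Ω) (hF : ContDiffOn ℝ (⊤ : ℕ∞) F Ω) (v : V) :
    ContDiffOn ℝ (⊤ : ℕ∞) (dirD v F) Ω :=
  (hF.fderiv_of_isOpen hΩ (m := (⊤ : ℕ∞)) (by simp)).clm_apply contDiffOn_const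

lemma dirD_congr (hΩ : IsOpen Ω) (h : ∀ x ∈ Ω, F x = G x) (v : V) (hp : p ∈ Ω) :
    dirD v F p = dirD v G p := by
  have : F =ᶠ[nhds p] G := Filter.eventually_of_mem (hΩ.mem_nhds hp) h
  simp only [dirD, this.fderiv_eq]

lemma dirD_mul (v : V) (hF : DifferentiableAt ℝ F p) (hG : DifferentiableAt ℝ G p) :
    dirD v (fun x => F x * G x) p = F p * dirD v G p + dirD v F p * G p := by
  simp [dirD, fderiv_fun_mul hF hG, mul_comm]

lemma dirD_add (v : V) (hF : DifferentiableAt ℝ F p) (hG : DifferentiableAt ℝ G p) :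
    dirD v (fun x => F x + G x) p = dirD v F p + dirD v G p := by
  simp [dirD, fderiv_fun_add hF hG]

lemma dirD_sub (v : V) (hF : DifferentiableAt ℝ F p) (hG : DifferentiableAt ℝ G p) :
    dirD v (fun x => F x - G x) p = dirD v F p - dirD v G p := by
  simp [dirD, fderiv_fun_sub hF hG]

lemma dirD_sq (v : V) (hF : DifferentiableAt ℝ F p) :
    dirD v (fun x => F x ^ 2) p = 2 * F p * dirD v F p := by
  simp [dirD, fderiv_fun_pow 2 hF]

lemma dirD_sum {ι : Type*} (s : Finset ι) (v : V) {F : ι → V → ℝ}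
    (hF : ∀ i ∈ s, DifferentiableAt ℝ (F i) p) :
    dirD v (fun x => ∑ i ∈ s, F i x) p = ∑ i ∈ s, dirD v (F i) p := by
  simp [dirD, fderiv_fun_sum hF]

lemma dirD_comm (hΩ : IsOpen Ω) (hF : ContDiffOn ℝ (⊤ : ℕ∞) F Ω) (v w : V) (hp : p ∈ Ω) :
    dirD v (dirD w F) p = dirD w (dirD v F) p := by
  have hd : DifferentiableAt ℝ (fderiv ℝ F) p :=
    ((hF.fderiv_of_isOpen hΩ (m := (⊤ : ℕ∞)) (by simp)).contDiffAt
      (hΩ.mem_nhds hp)).differentiableAt (by simp)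
  have key : ∀ a b : V, dirD a (dirD b F) p = fderiv ℝ (fderiv ℝ F) p a b := fun a b => by
    change fderiv ℝ (fun x => fderiv ℝ F x b) p a = _
    rw [fderiv_clm_apply hd (by fun_prop)]
    simp
  rw [key, key]
  exact ((hF.contDiffAt (hΩ.mem_nhds hp)).isSymmSndFDerivAt
    (by simpa using WithTop.coe_le_coe.2 (le_top : (2 : ℕ∞) ≤ ⊤))) v w

lemma hasDerivAt_comp_line (v : V) (r : ℝ) (hF : DifferentiableAt ℝ F (p + r • v)) :
    HasDerivAt (fun s : ℝ => F (p + s • v)) (dirD v F (p + r • v)) r := by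
  have h : HasDerivAt (fun s : ℝ => p + s • v) v r := by
    simpa using ((hasDerivAt_id r).smul_const v).const_add p
  exact hF.hasFDerivAt.comp_hasDerivAt r h

/-- First and second order conditions at a maximum along a line. -/
lemma dirD_of_line_max (hΩ : IsOpen Ω) (hF : ContDiffOn ℝ (⊤ : ℕ∞) F Ω) (hp : p ∈ Ω) (v : V)
    (hmax : ∀ᶠ r : ℝ in nhds 0, F (p + r • v) ≤ F p) :
    dirD v F p = 0 ∧ dirD v (dirD v F) p ≤ 0 := by
  set g : ℝ → ℝ := fun r => F (p + r • v) with hg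
  have hmem : ∀ᶠ r : ℝ in nhds 0, p + r • v ∈ Ω := by
    have hc : Continuous fun r : ℝ => p + r • v := by fun_prop
    exact hc.continuousAt.eventually (hΩ.mem_nhds (by simpa using hp))
  have hd : ∀ᶠ r : ℝ in nhds 0, HasDerivAt g (dirD v F (p + r • v)) r :=
    hmem.mono fun r hr => hasDerivAt_comp_line v r (hF.diffAt_of_isOpen hΩ hr)
  have h0 : HasDerivAt g (dirD v F p) 0 := by simpa using hd.self_of_nhds
  have hloc : IsLocalMax g 0 := by
    simpa [IsLocalMax, IsMaxFilter, hg] using hmax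
  have hz : dirD v F p = 0 := hloc.hasDerivAt_eq_zero h0
  refine ⟨hz, ?_⟩
  have hdd : deriv g =ᶠ[nhds 0] fun r => dirD v F (p + r • v) := hd.mono fun r hr => hr.deriv
  have h1 : HasDerivAt (fun r : ℝ => dirD v F (p + r • v)) (dirD v (dirD v F) p) 0 := by
    have := hasDerivAt_comp_line (F := dirD v F) (p := p) v 0
      (by simpa using (hF.dirD hΩ v).diffAt_of_isOpen hΩ hp)
    simpa using this
  have h2 : deriv (deriv g) 0 = dirD v (dirD v F) p := (hdd.deriv_eq).trans h1.deriv
  by_contra hcon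
  push Not at hcon
  have hmin : IsLocalMin g 0 :=
    isLocalMin_of_deriv_deriv_pos (by rw [h2]; exact hcon) (by rw [h0.deriv, hz])
      h0.continuousAt
  have hconst : g =ᶠ[nhds 0] fun _ => g 0 := by
    filter_upwards [hloc, hmin] with r h3 h4 using le_antisymm h3 h4
  have : deriv (deriv g) 0 = 0 := by
    rw [hconst.deriv.deriv_eq]; simp
  linarith

end DirectionalCalculus

section Evolution

variable {V : Type*} [NormedAddCommGroup V] [NormedSpace ℝ V] {Ω : Set V} {ι : Type*} [Fintype ι]
  {f φ : V → ℝ} {e : ι → V} {t : V} {p : V}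

/-- Evolution of `∂ₜ f` when `∂ₜ f = L f + |∇f|²`. -/
lemma evolution_time_deriv (hΩ : IsOpen Ω) (hf : ContDiffOn ℝ (⊤ : ℕ∞) f Ω)
    (hφ : ContDiffOn ℝ (⊤ : ℕ∞) φ Ω) (hφt : ∀ x ∈ Ω, dirD t φ x = 0)
    (heq : ∀ x ∈ Ω, dirD t f x =
      ∑ i, (dirD (e i) (dirD (e i) f) x - dirD (e i) φ x * dirD (e i) f x + dirD (e i) f x ^ 2))
    (hp : p ∈ Ω) :
    dirD t (dirD t f) p =
      ∑ i, (dirD (e i) (dirD (e i) (dirD t f)) p - dirD (e i) φ p * dirD (e i) (dirD t f) p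
        + 2 * dirD (e i) f p * dirD (e i) (dirD t f) p) := by
  have d1 : ∀ i, DifferentiableAt ℝ (dirD (e i) f) p := fun i =>
    (hf.dirD hΩ (e i)).diffAt_of_isOpen hΩ hp
  have d2 : ∀ i, DifferentiableAt ℝ (dirD (e i) (dirD (e i) f)) p := fun i =>
    ((hf.dirD hΩ (e i)).dirD hΩ (e i)).diffAt_of_isOpen hΩ hp
  have d3 : ∀ i, DifferentiableAt ℝ (dirD (e i) φ) p := fun i =>
    (hφ.dirD hΩ (e i)).diffAt_of_isOpen hΩ hp
  rw [dirD_congr hΩ heq t hp, dirD_sum _ _ (fun i _ => by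
    have := d1 i; have := d2 i; have := d3 i; fun_prop)]
  refine Finset.sum_congr rfl fun i _ => ?_
  rw [dirD_add _ (by have := d1 i; have := d2 i; have := d3 i; fun_prop)
      (by have := d1 i; fun_prop), dirD_sub _ (d2 i) (by have := d1 i; have := d3 i; fun_prop),
    dirD_mul _ (d3 i) (d1 i), dirD_sq _ (d1 i)]
  have c1 : ∀ x ∈ Ω, dirD t (dirD (e i) f) x = dirD (e i) (dirD t f) x := fun x hx =>
    dirD_comm hΩ hf _ _ hx
  have c2 : dirD t (dirD (e i) φ) p = 0 := by
    rw [dirD_comm hΩ hφ _ _ hp, dirD_congr (G := fun _ => 0) hΩ hφt _ hp]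
    simp [dirD]
  rw [dirD_comm hΩ (hf.dirD hΩ (e i)) _ _ hp, dirD_congr hΩ c1 _ hp, c1 p hp, c2]
  ring

lemma dirD_normSq (hΩ : IsOpen Ω) (hf : ContDiffOn ℝ (⊤ : ℕ∞) f Ω) (v : V) (hp : p ∈ Ω) :
    dirD v (fun x => ∑ j, dirD (e j) f x ^ 2) p =
      ∑ j, 2 * dirD (e j) f p * dirD v (dirD (e j) f) p := by
  have d1 : ∀ i, DifferentiableAt ℝ (dirD (e i) f) p := fun i =>
    (hf.dirD hΩ (e i)).diffAt_of_isOpen hΩ hp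
  rw [dirD_sum _ _ (fun i _ => by have := d1 i; fun_prop)]
  exact Finset.sum_congr rfl fun i _ => dirD_sq _ (d1 i)

lemma dirD_dirD_normSq (hΩ : IsOpen Ω) (hf : ContDiffOn ℝ (⊤ : ℕ∞) f Ω) (v : V) (hp : p ∈ Ω) :
    dirD v (dirD v (fun x => ∑ j, dirD (e j) f x ^ 2)) p =
      ∑ j, (2 * dirD v (dirD (e j) f) p ^ 2
        + 2 * dirD (e j) f p * dirD v (dirD v (dirD (e j) f)) p) := by
  have d1 : ∀ i, DifferentiableAt ℝ (dirD (e i) f) p := fun i =>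
    (hf.dirD hΩ (e i)).diffAt_of_isOpen hΩ hp
  have d2 : ∀ i, DifferentiableAt ℝ (dirD v (dirD (e i) f)) p := fun i =>
    ((hf.dirD hΩ (e i)).dirD hΩ v).diffAt_of_isOpen hΩ hp
  rw [dirD_congr hΩ (fun x hx => dirD_normSq hΩ hf v hx) v hp,
    dirD_sum _ _ (fun i _ => by have := d1 i; have := d2 i; fun_prop)]
  refine Finset.sum_congr rfl fun i _ => ?_
  rw [dirD_mul _ (by have := d1 i; fun_prop) (d2 i)]
  have : dirD v (fun x => 2 * dirD (e i) f x) p = 2 * dirD v (dirD (e i) f) p := by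
    rw [dirD_mul _ (by fun_prop) (d1 i)]; simp [dirD]
  rw [this]
  ring

/-- Evolution of `|∇f|²` (Bochner's formula) when `∂ₜ f = L f + |∇f|²`. -/
lemma evolution_normSq (hΩ : IsOpen Ω) (hf : ContDiffOn ℝ (⊤ : ℕ∞) f Ω)
    (hφ : ContDiffOn ℝ (⊤ : ℕ∞) φ Ω)
    (heq : ∀ x ∈ Ω, dirD t f x =
      ∑ i, (dirD (e i) (dirD (e i) f) x - dirD (e i) φ x * dirD (e i) f x + dirD (e i) f x ^ 2))
    (hp : p ∈ Ω) :
    dirD t (fun x => ∑ j, dirD (e j) f x ^ 2) p =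
      ∑ i, (dirD (e i) (dirD (e i) (fun x => ∑ j, dirD (e j) f x ^ 2)) p
        - dirD (e i) φ p * dirD (e i) (fun x => ∑ j, dirD (e j) f x ^ 2) p
        + 2 * dirD (e i) f p * dirD (e i) (fun x => ∑ j, dirD (e j) f x ^ 2) p)
      - 2 * ∑ i, ∑ j, dirD (e i) (dirD (e j) f) p ^ 2
      - 2 * ∑ i, ∑ j, dirD (e j) (dirD (e i) φ) p * dirD (e i) f p * dirD (e j) f p := by
  have d1 : ∀ i, DifferentiableAt ℝ (dirD (e i) f) p := fun i =>
    (hf.dirD hΩ (e i)).diffAt_of_isOpen hΩ hp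
  have d2 : ∀ i, DifferentiableAt ℝ (dirD (e i) (dirD (e i) f)) p := fun i =>
    ((hf.dirD hΩ (e i)).dirD hΩ (e i)).diffAt_of_isOpen hΩ hp
  have d3 : ∀ i, DifferentiableAt ℝ (dirD (e i) φ) p := fun i =>
    (hφ.dirD hΩ (e i)).diffAt_of_isOpen hΩ hp
  have step : ∀ j, dirD t (dirD (e j) f) p =
      ∑ i, (dirD (e i) (dirD (e i) (dirD (e j) f)) p
        - dirD (e j) (dirD (e i) φ) p * dirD (e i) f p
        - dirD (e i) φ p * dirD (e i) (dirD (e j) f) p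
        + 2 * dirD (e i) f p * dirD (e i) (dirD (e j) f) p) := by
    intro j
    rw [dirD_comm hΩ hf _ _ hp, dirD_congr hΩ heq _ hp, dirD_sum _ _ (fun i _ => by
      have := d1 i; have := d2 i; have := d3 i; fun_prop)]
    refine Finset.sum_congr rfl fun i _ => ?_
    rw [dirD_add _ (by have := d1 i; have := d2 i; have := d3 i; fun_prop)
        (by have := d1 i; fun_prop), dirD_sub _ (d2 i) (by have := d1 i; have := d3 i; fun_prop),
      dirD_mul _ (d3 i) (d1 i), dirD_sq _ (d1 i)]
    have c1 : ∀ x ∈ Ω, dirD (e j) (dirD (e i) f) x = dirD (e i) (dirD (e j) f) x := fun x hx =>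
      dirD_comm hΩ hf _ _ hx
    rw [dirD_comm hΩ (hf.dirD hΩ (e i)) _ _ hp, dirD_congr hΩ c1 _ hp, c1 p hp]
    ring
  rw [dirD_normSq hΩ hf t hp]
  simp_rw [dirD_dirD_normSq hΩ hf _ hp, dirD_normSq hΩ hf _ hp, step, Finset.mul_sum]
  rw [Finset.sum_comm, ← Finset.sum_sub_distrib, ← Finset.sum_sub_distrib]
  refine Finset.sum_congr rfl fun i _ => ?_
  rw [← Finset.sum_sub_distrib, ← Finset.sum_add_distrib, ← Finset.sum_sub_distrib,
    ← Finset.sum_sub_distrib]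
  refine Finset.sum_congr rfl fun j _ => ?_
  ring

/-- Evolution of the Hamilton quantity `|∇f|² - α ∂ₜ f`. -/
lemma evolution_hamilton (hΩ : IsOpen Ω) (hf : ContDiffOn ℝ (⊤ : ℕ∞) f Ω)
    (hφ : ContDiffOn ℝ (⊤ : ℕ∞) φ Ω) (hφt : ∀ x ∈ Ω, dirD t φ x = 0)
    (heq : ∀ x ∈ Ω, dirD t f x =
      ∑ i, (dirD (e i) (dirD (e i) f) x - dirD (e i) φ x * dirD (e i) f x + dirD (e i) f x ^ 2))
    {α : V → ℝ} (hα : ContDiffOn ℝ (⊤ : ℕ∞) α Ω) (hαe : ∀ i, ∀ x ∈ Ω, dirD (e i) α x = 0)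
    {G : V → ℝ} (hG : G = fun x => (∑ j, dirD (e j) f x ^ 2) - α x * dirD t f x)
    (hp : p ∈ Ω) :
    dirD t G p =
      ∑ i, (dirD (e i) (dirD (e i) G) p - dirD (e i) φ p * dirD (e i) G p
        + 2 * dirD (e i) f p * dirD (e i) G p)
      - 2 * ∑ i, ∑ j, dirD (e i) (dirD (e j) f) p ^ 2
      - 2 * ∑ i, ∑ j, dirD (e j) (dirD (e i) φ) p * dirD (e i) f p * dirD (e j) f p
      - dirD t α p * dirD t f p := by
  have hq : ContDiffOn ℝ (⊤ : ℕ∞) (fun x => ∑ j, dirD (e j) f x ^ 2) Ω :=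
    ContDiffOn.sum fun i _ => (hf.dirD hΩ (e i)).pow 2
  have hP := hf.dirD hΩ t
  have hD : ∀ v, ∀ x ∈ Ω, dirD v G x = dirD v (fun x => ∑ j, dirD (e j) f x ^ 2) x
      - (α x * dirD v (dirD t f) x + dirD v α x * dirD t f x) := fun v x hx => by
    have h1 := hα.diffAt_of_isOpen hΩ hx
    have h2 := hP.diffAt_of_isOpen hΩ hx
    rw [hG, dirD_sub _ (hq.diffAt_of_isOpen hΩ hx) (by fun_prop), dirD_mul _ h1 h2]
  have hDe : ∀ i, ∀ x ∈ Ω, dirD (e i) G x = dirD (e i) (fun x => ∑ j, dirD (e j) f x ^ 2) x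
      - α x * dirD (e i) (dirD t f) x := fun i x hx => by
    rw [hD _ x hx, hαe i x hx]; ring
  have hDDe : ∀ i, dirD (e i) (dirD (e i) G) p =
      dirD (e i) (dirD (e i) (fun x => ∑ j, dirD (e j) f x ^ 2)) p
        - α p * dirD (e i) (dirD (e i) (dirD t f)) p := fun i => by
    have h1 := hα.diffAt_of_isOpen hΩ hp
    have h2 := (hP.dirD hΩ (e i)).diffAt_of_isOpen hΩ hp
    rw [dirD_congr hΩ (hDe i) _ hp, dirD_sub _ ((hq.dirD hΩ (e i)).diffAt_of_isOpen hΩ hp)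
      (by fun_prop), dirD_mul _ h1 h2, hαe i p hp]
    ring
  rw [hD t p hp, evolution_normSq hΩ hf hφ heq hp, evolution_time_deriv hΩ hf hφ hφt heq hp]
  simp_rw [hDDe, hDe _ p hp]
  have : ∀ i, (dirD (e i) (dirD (e i) (fun x => ∑ j, dirD (e j) f x ^ 2)) p
        - α p * dirD (e i) (dirD (e i) (dirD t f)) p
        - dirD (e i) φ p * (dirD (e i) (fun x => ∑ j, dirD (e j) f x ^ 2) p
          - α p * dirD (e i) (dirD t f) p)
        + 2 * dirD (e i) f p * (dirD (e i) (fun x => ∑ j, dirD (e j) f x ^ 2) p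
          - α p * dirD (e i) (dirD t f) p)) =
      (dirD (e i) (dirD (e i) (fun x => ∑ j, dirD (e j) f x ^ 2)) p
        - dirD (e i) φ p * dirD (e i) (fun x => ∑ j, dirD (e j) f x ^ 2) p
        + 2 * dirD (e i) f p * dirD (e i) (fun x => ∑ j, dirD (e j) f x ^ 2) p)
      - α p * (dirD (e i) (dirD (e i) (dirD t f)) p - dirD (e i) φ p * dirD (e i) (dirD t f) p
        + 2 * dirD (e i) f p * dirD (e i) (dirD t f) p) := fun i => by ring
  simp_rw [this]
  rw [Finset.sum_sub_distrib, ← Finset.mul_sum]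
  ring

end Evolution

section Algebra

/-- Cauchy–Schwarz for the trace, in the form used for the Bakry–Émery condition. -/
lemma sq_trace_sub_div_le {n : ℕ} (hn : 1 ≤ n) {m : ℝ} (hm : (n : ℝ) < m)
    (a : Fin n → Fin n → ℝ) (b : ℝ) :
    ((∑ i, a i i) - b) ^ 2 / m ≤ (∑ i, ∑ j, a i j ^ 2) + b ^ 2 / (m - n) := by
  have hn0 : (0 : ℝ) < n := by exact_mod_cast hn
  have hmn : 0 < m - n := by linarith
  have hm0 : 0 < m := by linarith
  have h1 : (∑ i, a i i) ^ 2 ≤ n * ∑ i, ∑ j, a i j ^ 2 := by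
    calc (∑ i, a i i) ^ 2 ≤ n * ∑ i, a i i ^ 2 := by
          simpa using sq_sum_le_card_mul_sum_sq (s := (Finset.univ : Finset (Fin n)))
            (f := fun i => a i i)
      _ ≤ _ := by
          gcongr with i
          exact Finset.single_le_sum (f := fun j => a i j ^ 2) (fun j _ => sq_nonneg _)
            (Finset.mem_univ i)
  set A := ∑ i, a i i
  have h2 : A ^ 2 / n ≤ ∑ i, ∑ j, a i j ^ 2 := by
    rw [div_le_iff₀ hn0]; linarith
  have h3 : (A - b) ^ 2 / m ≤ A ^ 2 / n + b ^ 2 / (m - n) := by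
    rw [div_add_div _ _ hn0.ne' hmn.ne', div_le_div_iff₀ hm0 (by positivity)]
    nlinarith [sq_nonneg (A * (m - n) + n * b)]
  linarith

/-- The estimate available at an interior maximum of `θ(t) ζ² G`, where `G = |∇f|² - α ∂ₜ f`. -/
lemma max_point_estimate {ι : Type*} [Fintype ι] {f z zz g gg w : ι → ℝ}
    {ζ G Gt q P m α K τ C Z : ℝ} (hζ : 0 < ζ) (hζ1 : ζ ≤ 1) (hG : 0 < G) (hm : 0 < m)
    (hα : 1 < α) (hK : 0 ≤ K) (hτ : 0 < τ) (hC : 0 ≤ C)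
    (hq : q = ∑ i, f i ^ 2) (hGP : G = q - α * P)
    (h1 : ∀ i, 2 * ζ * z i * G + ζ ^ 2 * g i = 0)
    (h2 : ∀ i, (2 * z i ^ 2 + 2 * ζ * zz i) * G + 4 * ζ * z i * g i + ζ ^ 2 * gg i ≤ 0)
    (ht : 0 ≤ (1 / τ - 4 * K) * G + Gt)
    (hev : Gt ≤ ∑ i, (gg i - w i * g i + 2 * f i * g i) - 2 / m * (q - P) ^ 2 + 2 * K * G)
    (hL : -∑ i, (zz i - w i * z i) ≤ C) (hZ : ∑ i, z i ^ 2 ≤ Z) :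
    2 / (m * α ^ 2) * (ζ ^ 2 * G) ≤ 1 / τ + 6 * Z + 2 * C + m * α ^ 2 / (α - 1) * Z := by
  have hα1 : 0 < α - 1 := by linarith
  have hα0 : 0 < α := by linarith
  set c := 4 * (α - 1) / (m * α ^ 2) with hc
  have hc0 : 0 < c := by positivity
  have hc4 : 4 / c = m * α ^ 2 / (α - 1) := by rw [hc]; field_simp
  have hg : ∀ i, ζ * g i = -2 * z i * G := fun i => by
    have : ζ * (ζ * g i + 2 * z i * G) = 0 := by linear_combination h1 i
    rcases mul_eq_zero.1 this with h | h
    · exact absurd h hζ.ne'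
    · linarith
  have hi : ∀ i, ζ ^ 2 * (gg i - w i * g i + 2 * f i * g i) ≤
      G * (6 * z i ^ 2 - 2 * ζ * (zz i - w i * z i) + c * ζ ^ 2 * f i ^ 2 + 4 / c * z i ^ 2) := by
    intro i
    have am : -4 * (ζ * f i) * z i ≤ c * ζ ^ 2 * f i ^ 2 + 4 / c * z i ^ 2 := by
      have : c * ζ ^ 2 * f i ^ 2 + 4 / c * z i ^ 2 - -4 * (ζ * f i) * z i
          = (c * (ζ * f i) + 2 * z i) ^ 2 / c := by field_simp; ring
      have h0 : 0 ≤ (c * (ζ * f i) + 2 * z i) ^ 2 / c := by positivity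
      linarith
    have am' := mul_le_mul_of_nonneg_left am hG.le
    have e1 : ζ ^ 2 * (-w i * g i + 2 * f i * g i) =
        G * (2 * ζ * w i * z i) + G * (-4 * (ζ * f i) * z i) := by
      linear_combination (ζ * (-w i + 2 * f i)) * hg i
    have e2 : 4 * ζ * z i * g i = -8 * z i ^ 2 * G := by linear_combination 4 * z i * hg i
    have := h2 i
    nlinarith
  have hsum : ζ ^ 2 * ∑ i, (gg i - w i * g i + 2 * f i * g i) ≤
      G * (6 * (∑ i, z i ^ 2) - 2 * ζ * (∑ i, (zz i - w i * z i)) + c * ζ ^ 2 * q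
        + 4 / c * ∑ i, z i ^ 2) := by
    calc _ = ∑ i, ζ ^ 2 * (gg i - w i * g i + 2 * f i * g i) := Finset.mul_sum ..
      _ ≤ _ := Finset.sum_le_sum fun i _ => hi i
      _ = _ := by
        rw [← Finset.mul_sum, hq, Finset.sum_add_distrib, Finset.sum_add_distrib,
          Finset.sum_sub_distrib]
        simp only [← Finset.mul_sum]
  have hb : 6 * (∑ i, z i ^ 2) - 2 * ζ * (∑ i, (zz i - w i * z i)) + c * ζ ^ 2 * q
      + 4 / c * ∑ i, z i ^ 2 ≤ 6 * Z + 2 * C + c * ζ ^ 2 * q + 4 / c * Z := by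
    have : ζ * (-∑ i, (zz i - w i * z i)) ≤ 1 * C :=
      (mul_le_mul_of_nonneg_left hL hζ.le).trans (mul_le_mul_of_nonneg_right hζ1 hC)
    have h4 : 4 / c * ∑ i, z i ^ 2 ≤ 4 / c * Z := by gcongr
    linarith
  have hb' := mul_le_mul_of_nonneg_left hb hG.le
  have hquad : G * (2 / (m * α ^ 2) * G + c * q) ≤ 2 / m * (q - P) ^ 2 := by
    have e : q - P = (G + (α - 1) * q) / α := by
      rw [hGP]; field_simp; ring
    have : 2 / m * (q - P) ^ 2 - G * (2 / (m * α ^ 2) * G + c * q)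
        = 2 / (m * α ^ 2) * ((α - 1) * q) ^ 2 := by
      rw [e, hc]; field_simp; ring
    have h0 : 0 ≤ 2 / (m * α ^ 2) * ((α - 1) * q) ^ 2 := by positivity
    linarith
  have hζ2 : 0 < ζ ^ 2 := by positivity
  have hζ21 : ζ ^ 2 ≤ 1 := pow_le_one₀ hζ.le hζ1
  have k1 := mul_le_mul_of_nonneg_left hquad hζ2.le
  have k2 := mul_le_mul_of_nonneg_left hev hζ2.le
  have k3 := mul_nonneg hζ2.le ht
  have k4 : 0 ≤ ζ ^ 2 * (K * G) := by positivity
  have k5 : ζ ^ 2 * (1 / τ * G) ≤ 1 * (1 / τ * G) := by gcongr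
  rw [← hc4]
  refine le_of_mul_le_mul_left ?_ hG
  nlinarith

end Algebra

section Cutoff

/-- The `i`-th spatial direction in space-time. -/
def spaceDir (n : ℕ) (i : Fin n) : ℝ × EuclideanSpace ℝ (Fin n) := (0, EuclideanSpace.single i 1)

lemma dirD_eq_of_hasDerivAt {V : Type*} [NormedAddCommGroup V] [NormedSpace ℝ V] {F : V → ℝ}
    {p v : V} {c : ℝ} (hF : DifferentiableAt ℝ F p)
    (h : HasDerivAt (fun s : ℝ => F (p + s • v)) c 0) : dirD v F p = c := by
  have := hasDerivAt_comp_line (F := F) (p := p) v 0 (by simpa using hF)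
  simp only [zero_smul, add_zero] at this
  exact this.unique h

lemma one_add_norm_sq_line {n : ℕ} (x : EuclideanSpace ℝ (Fin n)) (i : Fin n) (s : ℝ) :
    1 + ‖x + s • EuclideanSpace.single i (1 : ℝ)‖ ^ 2 = 1 + ‖x‖ ^ 2 + 2 * s * x i + s ^ 2 := by
  rw [norm_add_sq_real, inner_smul_right, norm_smul, EuclideanSpace.inner_single_right]
  simp
  ring

lemma hasDerivAt_quadratic_zero (a b : ℝ) :
    HasDerivAt (fun s : ℝ => a + 2 * s * b + s ^ 2) (2 * b) 0 := by
  have h1 := (((hasDerivAt_id (0 : ℝ)).const_mul 2).mul_const b).const_add a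
  exact (h1.add ((hasDerivAt_id (0 : ℝ)).pow 2)).congr_deriv (by simp)

lemma contDiff_log_weight (n : ℕ) : ContDiff ℝ (⊤ : ℕ∞)
    (fun p : ℝ × EuclideanSpace ℝ (Fin n) => Real.log (1 + ‖p.2‖ ^ 2)) := by
  refine ContDiff.log (contDiff_const.add (contDiff_snd.norm_sq ℝ)) fun p => ?_
  positivity

lemma dirD_log_weight {n : ℕ} (i : Fin n) (p : ℝ × EuclideanSpace ℝ (Fin n)) :
    dirD (spaceDir n i) (fun p => Real.log (1 + ‖p.2‖ ^ 2)) p = 2 * p.2 i / (1 + ‖p.2‖ ^ 2) := by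
  refine dirD_eq_of_hasDerivAt ((contDiff_log_weight n).differentiable (by simp) p) ?_
  simp only [spaceDir, Prod.snd_add, Prod.smul_snd, one_add_norm_sq_line]
  have h := hasDerivAt_quadratic_zero (1 + ‖p.2‖ ^ 2) (p.2 i)
  have := h.log (by simp; positivity)
  simpa using this

lemma dirD_dirD_log_weight {n : ℕ} (i : Fin n) (p : ℝ × EuclideanSpace ℝ (Fin n)) :
    dirD (spaceDir n i) (dirD (spaceDir n i) (fun p => Real.log (1 + ‖p.2‖ ^ 2))) p =
      2 / (1 + ‖p.2‖ ^ 2) - 4 * p.2 i ^ 2 / (1 + ‖p.2‖ ^ 2) ^ 2 := by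
  have hd : DifferentiableAt ℝ
      (dirD (spaceDir n i) (fun p => Real.log (1 + ‖p.2‖ ^ 2))) p :=
    ((contDiff_log_weight n).contDiffOn.dirD isOpen_univ _).diffAt_of_isOpen isOpen_univ trivial
  refine dirD_eq_of_hasDerivAt hd ?_
  simp only [dirD_log_weight]
  simp only [spaceDir, Prod.snd_add, Prod.smul_snd, one_add_norm_sq_line]
  have h := hasDerivAt_quadratic_zero (1 + ‖p.2‖ ^ 2) (p.2 i)
  have h' : HasDerivAt
      (fun s : ℝ => 2 * (p.2 + s • EuclideanSpace.single i (1 : ℝ)) i) 2 0 := by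
    have h1 := ((hasDerivAt_id (0 : ℝ)).const_add (p.2 i)).const_mul 2
    simpa using h1
  have hne : (1 + ‖p.2‖ ^ 2 : ℝ) ≠ 0 := by positivity
  refine (h'.div h (by simpa using hne)).congr_deriv ?_
  simp only [zero_smul, add_zero, mul_zero, zero_mul, ne_eq, OfNat.ofNat_ne_zero,
    not_false_eq_true, zero_pow]
  field_simp
  ring

/-- Logarithmic cutoff in the space variable. -/
def logCutoff (n : ℕ) (R : ℝ) (p : ℝ × EuclideanSpace ℝ (Fin n)) : ℝ :=
  1 + (-1 / R) * Real.log (1 + ‖p.2‖ ^ 2)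

lemma contDiff_logCutoff (n : ℕ) (R : ℝ) : ContDiff ℝ (⊤ : ℕ∞) (logCutoff n R) :=
  contDiff_const.add (contDiff_const.mul (contDiff_log_weight n))

lemma dirD_const_add_const_mul {V : Type*} [NormedAddCommGroup V] [NormedSpace ℝ V] {F : V → ℝ}
    {p : V} (v : V) (a c : ℝ) (hF : DifferentiableAt ℝ F p) :
    dirD v (fun x => a + c * F x) p = c * dirD v F p := by
  simp [dirD, fderiv_const_add, fderiv_const_mul hF]

lemma dirD_logCutoff {n : ℕ} (R : ℝ) (i : Fin n) (p : ℝ × EuclideanSpace ℝ (Fin n)) :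
    dirD (spaceDir n i) (logCutoff n R) p = (-1 / R) * (2 * p.2 i / (1 + ‖p.2‖ ^ 2)) := by
  rw [← dirD_log_weight]
  exact dirD_const_add_const_mul _ _ _ ((contDiff_log_weight n).differentiable (by simp) p)

lemma dirD_dirD_logCutoff {n : ℕ} (R : ℝ) (i : Fin n) (p : ℝ × EuclideanSpace ℝ (Fin n)) :
    dirD (spaceDir n i) (dirD (spaceDir n i) (logCutoff n R)) p =
      (-1 / R) * (2 / (1 + ‖p.2‖ ^ 2) - 4 * p.2 i ^ 2 / (1 + ‖p.2‖ ^ 2) ^ 2) := by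
  have hd : DifferentiableAt ℝ
      (dirD (spaceDir n i) (fun p => Real.log (1 + ‖p.2‖ ^ 2))) p :=
    ((contDiff_log_weight n).contDiffOn.dirD isOpen_univ _).diffAt_of_isOpen isOpen_univ trivial
  have h : dirD (spaceDir n i) (logCutoff n R) = fun p =>
      0 + (-1 / R) * dirD (spaceDir n i) (fun p => Real.log (1 + ‖p.2‖ ^ 2)) p := by
    ext p; rw [dirD_logCutoff, dirD_log_weight, zero_add]
  rw [h, dirD_const_add_const_mul _ _ _ hd, dirD_dirD_log_weight]

lemma sum_sq_dirD_logCutoff_le {n : ℕ} {R : ℝ} (hR : 1 ≤ R)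
    (p : ℝ × EuclideanSpace ℝ (Fin n)) :
    ∑ i, dirD (spaceDir n i) (logCutoff n R) p ^ 2 ≤ 1 / R := by
  have hR0 : 0 < R := by linarith
  simp only [dirD_logCutoff]
  have : ∀ i, ((-1 / R) * (2 * p.2 i / (1 + ‖p.2‖ ^ 2))) ^ 2 =
      4 / (R ^ 2 * (1 + ‖p.2‖ ^ 2) ^ 2) * p.2 i ^ 2 := fun i => by field_simp; ring
  simp only [this]
  rw [← Finset.mul_sum, ← EuclideanSpace.real_norm_sq_eq, div_mul_eq_mul_div,
    div_le_div_iff₀ (by positivity) hR0]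
  have h1 : 4 * ‖p.2‖ ^ 2 ≤ (1 + ‖p.2‖ ^ 2) ^ 2 := by nlinarith [sq_nonneg (1 - ‖p.2‖ ^ 2)]
  have h2 : R ≤ R ^ 2 := by nlinarith
  calc 4 * ‖p.2‖ ^ 2 * R ≤ (1 + ‖p.2‖ ^ 2) ^ 2 * R ^ 2 := by gcongr
    _ = _ := by ring

lemma neg_sum_logCutoff_le {n : ℕ} {R C : ℝ} (hR : 1 ≤ R)
    (p : ℝ × EuclideanSpace ℝ (Fin n)) {w : Fin n → ℝ}
    (hw : -∑ i, w i * p.2 i ≤ C * (1 + ‖p.2‖ ^ 2)) :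
    -∑ i, (dirD (spaceDir n i) (dirD (spaceDir n i) (logCutoff n R)) p
      - w i * dirD (spaceDir n i) (logCutoff n R) p) ≤ (2 * n + 2 * C) / R := by
  have hR0 : 0 < R := by linarith
  simp only [dirD_logCutoff, dirD_dirD_logCutoff]
  set ρ := 1 + ‖p.2‖ ^ 2 with hρ
  have hρ1 : 1 ≤ ρ := by rw [hρ]; nlinarith [sq_nonneg ‖p.2‖]
  have hρ0 : 0 < ρ := by linarith
  have e : -∑ i, ((-1 / R) * (2 / ρ - 4 * p.2 i ^ 2 / ρ ^ 2)
      - w i * ((-1 / R) * (2 * p.2 i / ρ))) =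
      (2 * n / ρ - 4 / ρ ^ 2 * ∑ i, p.2 i ^ 2 + 2 / ρ * -∑ i, w i * p.2 i) / R := by
    have : ∀ i, (-1 / R) * (2 / ρ - 4 * p.2 i ^ 2 / ρ ^ 2) - w i * ((-1 / R) * (2 * p.2 i / ρ)) =
        -(1 / R * (2 / ρ)) + 4 / (R * ρ ^ 2) * p.2 i ^ 2 + 2 / (R * ρ) * (w i * p.2 i) := by
      intro i; field_simp; ring
    simp only [this, Finset.sum_add_distrib, ← Finset.mul_sum, Finset.sum_const,
      Finset.card_univ, Fintype.card_fin, nsmul_eq_mul]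
    field_simp
    ring
  rw [e]
  refine div_le_div_of_nonneg_right ?_ hR0.le
  have h1 : 2 * n / ρ ≤ 2 * (n : ℝ) := div_le_self (by positivity) hρ1
  have h2 : 0 ≤ 4 / ρ ^ 2 * ∑ i, p.2 i ^ 2 :=
    mul_nonneg (by positivity) (Finset.sum_nonneg fun i _ => sq_nonneg _)
  have h3 : 2 / ρ * -∑ i, w i * p.2 i ≤ 2 / ρ * (C * ρ) :=
    mul_le_mul_of_nonneg_left hw (by positivity)
  have h4 : 2 / ρ * (C * ρ) = 2 * C := by field_simp
  linarith

end Cutoff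

section Hamilton

/-- The set of positive times in space-time. -/
def positiveTime (n : ℕ) : Set (ℝ × EuclideanSpace ℝ (Fin n)) := {p | 0 < p.1}

/-- The time direction in space-time. -/
def timeDir (n : ℕ) : ℝ × EuclideanSpace ℝ (Fin n) := (1, 0)

lemma isOpen_positiveTime (n : ℕ) : IsOpen (positiveTime n) :=
  isOpen_lt continuous_const continuous_fst

/-- Hamilton's quantity `|∇f|² - a e^{2Kt} ∂ₜ f`. -/
def hamiltonQuantity (n : ℕ) (K a : ℝ) (f : ℝ × EuclideanSpace ℝ (Fin n) → ℝ)
    (p : ℝ × EuclideanSpace ℝ (Fin n)) : ℝ :=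
  (∑ j, dirD (spaceDir n j) f p ^ 2) - a * Real.exp (2 * K * p.1) * dirD (timeDir n) f p

/-- `f` is the logarithm of a positive solution of the heat equation, written in space-time
coordinates, for a potential `Φ` on space-time that satisfies the curvature-dimension condition. -/
structure IsLogHeat (n : ℕ) (m K : ℝ) (Φ f : ℝ × EuclideanSpace ℝ (Fin n) → ℝ) : Prop where
  smooth : ContDiffOn ℝ (⊤ : ℕ∞) f (positiveTime n)
  smooth_potential : ContDiffOn ℝ (⊤ : ℕ∞) Φ (positiveTime n)
  potential_static : ∀ p ∈ positiveTime n, dirD (timeDir n) Φ p = 0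
  heat : ∀ p ∈ positiveTime n, dirD (timeDir n) f p =
    ∑ i, (dirD (spaceDir n i) (dirD (spaceDir n i) f) p
      - dirD (spaceDir n i) Φ p * dirD (spaceDir n i) f p + dirD (spaceDir n i) f p ^ 2)
  curvature : ∀ p ∈ positiveTime n, ∀ v : Fin n → ℝ,
    (∑ i, dirD (spaceDir n i) Φ p * v i) ^ 2 / (m - n) - K * ∑ i, v i ^ 2 ≤
      ∑ i, ∑ j, dirD (spaceDir n j) (dirD (spaceDir n i) Φ) p * v i * v j

variable {n : ℕ} {m K : ℝ} {Φ f : ℝ × EuclideanSpace ℝ (Fin n) → ℝ}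

lemma contDiff_exp_time (n : ℕ) (K a : ℝ) : ContDiff ℝ (⊤ : ℕ∞)
    (fun p : ℝ × EuclideanSpace ℝ (Fin n) => a * Real.exp (2 * K * p.1)) :=
  contDiff_const.mul (Real.contDiff_exp.comp (contDiff_const.mul contDiff_fst))

lemma dirD_spaceDir_exp_time (K a : ℝ) (i : Fin n) (p : ℝ × EuclideanSpace ℝ (Fin n)) :
    dirD (spaceDir n i) (fun p => a * Real.exp (2 * K * p.1)) p = 0 := by
  refine dirD_eq_of_hasDerivAt ((contDiff_exp_time n K a).differentiable (by simp) p) ?_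
  simp only [spaceDir, Prod.fst_add, Prod.smul_fst, smul_zero, add_zero]
  exact hasDerivAt_const _ _

lemma dirD_timeDir_exp_time (K a : ℝ) (p : ℝ × EuclideanSpace ℝ (Fin n)) :
    dirD (timeDir n) (fun p => a * Real.exp (2 * K * p.1)) p =
      2 * K * (a * Real.exp (2 * K * p.1)) := by
  refine dirD_eq_of_hasDerivAt ((contDiff_exp_time n K a).differentiable (by simp) p) ?_
  simp only [timeDir, Prod.fst_add, Prod.smul_fst, smul_eq_mul, mul_one]
  have h := ((((hasDerivAt_id (0 : ℝ)).const_add p.1).const_mul (2 * K)).exp).const_mul a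
  refine h.congr_deriv ?_
  simp
  ring

lemma IsLogHeat.contDiffOn_hamiltonQuantity (h : IsLogHeat n m K Φ f) (a : ℝ) :
    ContDiffOn ℝ (⊤ : ℕ∞) (hamiltonQuantity n K a f) (positiveTime n) := by
  have hΩ := isOpen_positiveTime n
  exact (ContDiffOn.sum fun i _ => (h.smooth.dirD hΩ _).pow 2).sub
    ((contDiff_exp_time n K a).contDiffOn.mul (h.smooth.dirD hΩ _))

lemma IsLogHeat.evolution_le (h : IsLogHeat n m K Φ f) (hn : 1 ≤ n) (hm : (n : ℝ) < m) (a : ℝ)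
    {p : ℝ × EuclideanSpace ℝ (Fin n)} (hp : p ∈ positiveTime n) :
    dirD (timeDir n) (hamiltonQuantity n K a f) p ≤
      ∑ i, (dirD (spaceDir n i) (dirD (spaceDir n i) (hamiltonQuantity n K a f)) p
        - dirD (spaceDir n i) Φ p * dirD (spaceDir n i) (hamiltonQuantity n K a f) p
        + 2 * dirD (spaceDir n i) f p * dirD (spaceDir n i) (hamiltonQuantity n K a f) p)
      - 2 / m * ((∑ j, dirD (spaceDir n j) f p ^ 2) - dirD (timeDir n) f p) ^ 2
      + 2 * K * hamiltonQuantity n K a f p := by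
  have hΩ := isOpen_positiveTime n
  rw [evolution_hamilton (e := spaceDir n) hΩ h.smooth h.smooth_potential h.potential_static
    h.heat (contDiff_exp_time n K a).contDiffOn (fun i x _ => dirD_spaceDir_exp_time K a i x)
    (G := hamiltonQuantity n K a f) rfl hp, dirD_timeDir_exp_time]
  have h1 := sq_trace_sub_div_le hn hm
    (fun i j => dirD (spaceDir n i) (dirD (spaceDir n j) f) p)
    (∑ i, dirD (spaceDir n i) Φ p * dirD (spaceDir n i) f p)
  have h2 := h.curvature p hp fun i => dirD (spaceDir n i) f p
  have h3 := h.heat p hp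
  rw [Finset.sum_add_distrib, Finset.sum_sub_distrib] at h3
  have h4 : ((∑ i, dirD (spaceDir n i) (dirD (spaceDir n i) f) p)
      - ∑ i, dirD (spaceDir n i) Φ p * dirD (spaceDir n i) f p) ^ 2 / m =
      1 / m * ((∑ j, dirD (spaceDir n j) f p ^ 2) - dirD (timeDir n) f p) ^ 2 := by
    rw [h3]; ring
  have h5 : 2 / m * ((∑ j, dirD (spaceDir n j) f p ^ 2) - dirD (timeDir n) f p) ^ 2 =
      2 * (1 / m * ((∑ j, dirD (spaceDir n j) f p ^ 2) - dirD (timeDir n) f p) ^ 2) := by ring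
  rw [h5, ← h4]
  simp only [hamiltonQuantity]
  linarith

lemma isCompact_log_weight_le (n : ℕ) (s T R : ℝ) :
    IsCompact {p : ℝ × EuclideanSpace ℝ (Fin n) |
      p.1 ∈ Set.Icc s T ∧ Real.log (1 + ‖p.2‖ ^ 2) ≤ R} := by
  refine ((isCompact_Icc (a := s) (b := T)).prod (isCompact_closedBall (0 : EuclideanSpace ℝ (Fin n))
    (Real.exp R))).of_isClosed_subset ?_ ?_
  · exact (isClosed_Icc.preimage continuous_fst).inter
      (isClosed_le (contDiff_log_weight n).continuous continuous_const)
  · rintro p ⟨h1, h2⟩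
    refine ⟨h1, ?_⟩
    rw [mem_closedBall_zero_iff]
    rw [Real.log_le_iff_le_exp (by positivity)] at h2
    nlinarith [sq_nonneg (‖p.2‖ - 1)]

/-- A one-sided maximum in time of a product `θ G` with `θ(t) = (t - s) e^{-4Kt}`. -/
lemma time_deriv_nonneg_of_max {g : ℝ → ℝ} {g' s t : ℝ} (hst : s < t) (hg : HasDerivAt g g' t)
    (hmax : ∀ r ∈ Set.Icc s t,
      (r - s) * Real.exp (-4 * K * r) * g r ≤ (t - s) * Real.exp (-4 * K * t) * g t) :
    0 ≤ (1 / (t - s) - 4 * K) * g t + g' := by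
  have hts : 0 < t - s := by linarith
  have h1 : HasDerivAt (fun r => (r - s) * Real.exp (-4 * K * r))
      (Real.exp (-4 * K * t) + (t - s) * (Real.exp (-4 * K * t) * (-4 * K))) t := by
    have ha := (hasDerivAt_id t).sub_const s
    have hb := ((hasDerivAt_id t).const_mul (-4 * K)).exp
    exact (ha.mul hb).congr_deriv (by simp)
  have h2 := h1.mul hg
  have h3 : 0 ≤ (Real.exp (-4 * K * t) + (t - s) * (Real.exp (-4 * K * t) * (-4 * K))) * g t
      + (t - s) * Real.exp (-4 * K * t) * g' := by
    refine ge_of_tendsto (h2.tendsto_slope.mono_left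
      (nhdsWithin_mono t (fun r (hr : r ∈ Set.Iio t) => ne_of_lt hr))) ?_
    filter_upwards [Ico_mem_nhdsLT hst] with r hr
    rw [slope_def_field]
    refine div_nonneg_of_nonpos ?_ (by linarith [hr.2])
    have := hmax r ⟨hr.1, hr.2.le⟩
    simpa using this
  have h4 : (Real.exp (-4 * K * t) + (t - s) * (Real.exp (-4 * K * t) * (-4 * K))) * g t
      + (t - s) * Real.exp (-4 * K * t) * g' =
      ((t - s) * Real.exp (-4 * K * t)) * ((1 / (t - s) - 4 * K) * g t + g') := by
    field_simp
    ring
  rw [h4] at h3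
  exact nonneg_of_mul_nonneg_right h3 (by positivity)

/-- Localized Hamilton estimate. -/
lemma IsLogHeat.hamilton_local (h : IsLogHeat n m K Φ f) (hn : 1 ≤ n) (hm : (n : ℝ) < m)
    (hK : 0 ≤ K) {C : ℝ} (hC : 0 ≤ C)
    (hgr : ∀ p ∈ positiveTime n, -∑ i, dirD (spaceDir n i) Φ p * p.2 i ≤ C * (1 + ‖p.2‖ ^ 2))
    {a s T R : ℝ} (ha : 1 < a) (hs : 0 < s) (hR : 1 ≤ R)
    {p : ℝ × EuclideanSpace ℝ (Fin n)} (hp : p.1 ∈ Set.Icc s T)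
    (hpR : Real.log (1 + ‖p.2‖ ^ 2) ≤ R) :
    (p.1 - s) * Real.exp (-4 * K * p.1) * (logCutoff n R p ^ 2 * hamiltonQuantity n K a f p) ≤
      m * a ^ 2 / 2 * (1 + T * (6 + 2 * (2 * n + 2 * C)
        + m * (a * Real.exp (2 * K * T)) ^ 2 / (a - 1)) / R) := by
  have hΩ := isOpen_positiveTime n
  have hm0 : 0 < m := lt_of_le_of_lt (Nat.cast_nonneg n) hm
  have hR0 : 0 < R := by linarith
  have ha1 : 0 < a - 1 := by linarith
  set G := hamiltonQuantity n K a f with hGdef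
  set ζ := logCutoff n R with hζdef
  set S := {p : ℝ × EuclideanSpace ℝ (Fin n) |
    p.1 ∈ Set.Icc s T ∧ Real.log (1 + ‖p.2‖ ^ 2) ≤ R} with hS
  have hSΩ : S ⊆ positiveTime n := fun x hx => lt_of_lt_of_le hs hx.1.1
  have hG := h.contDiffOn_hamiltonQuantity a
  have hζ : ContDiffOn ℝ (⊤ : ℕ∞) ζ (positiveTime n) := (contDiff_logCutoff n R).contDiffOn
  have hN : ContDiffOn ℝ (⊤ : ℕ∞) (fun x => ζ x ^ 2 * G x) (positiveTime n) := (hζ.pow 2).mul hG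
  set M : ℝ × EuclideanSpace ℝ (Fin n) → ℝ :=
    fun x => (x.1 - s) * Real.exp (-4 * K * x.1) * (ζ x ^ 2 * G x) with hM
  have hMc : ContinuousOn M S := by
    refine ContinuousOn.mul (Continuous.continuousOn (by fun_prop)) (hN.continuousOn.mono hSΩ)
  obtain ⟨z, hzS, hzmax⟩ := (isCompact_log_weight_le n s T R).exists_isMaxOn ⟨p, hp, hpR⟩ hMc
  refine (hzmax (⟨hp, hpR⟩ : p ∈ S)).trans ?_
  have hT : 0 < T := hs.trans_le (hzS.1.1.trans hzS.1.2)
  change M z ≤ _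
  by_cases hMz : M z ≤ 0
  · exact hMz.trans (by positivity)
  push Not at hMz
  have hzΩ := hSΩ hzS
  have hθ0 : 0 ≤ (z.1 - s) * Real.exp (-4 * K * z.1) :=
    mul_nonneg (by linarith [hzS.1.1]) (Real.exp_pos _).le
  have hθ : 0 < (z.1 - s) * Real.exp (-4 * K * z.1) := by
    refine lt_of_le_of_ne hθ0 fun h0 => ?_
    simp only [hM, ← h0, zero_mul, lt_irrefl] at hMz
  have hsz : 0 < z.1 - s := pos_of_mul_pos_left hθ (Real.exp_pos _).le
  have hNz : 0 < ζ z ^ 2 * G z := pos_of_mul_pos_right hMz hθ.le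
  have hGz : 0 < G z := pos_of_mul_pos_right hNz (sq_nonneg _)
  have hζne : ζ z ≠ 0 := fun h0 => by simp [h0] at hNz
  have hζeq : ∀ x, ζ x = 1 - Real.log (1 + ‖x.2‖ ^ 2) / R := fun x => by
    simp only [hζdef, logCutoff]; ring
  have hζz0 : 0 < ζ z := by
    refine lt_of_le_of_ne ?_ hζne.symm
    rw [hζeq, sub_nonneg, div_le_one hR0]
    exact hzS.2
  have hζz1 : ζ z ≤ 1 := by
    rw [hζeq, sub_le_self_iff]
    have : 0 ≤ Real.log (1 + ‖z.2‖ ^ 2) := Real.log_nonneg (by nlinarith [sq_nonneg ‖z.2‖])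
    positivity
  have hlt : Real.log (1 + ‖z.2‖ ^ 2) < R := by
    rw [hζeq, sub_pos, div_lt_one hR0] at hζz0
    exact hζz0
  -- spatial conditions at the maximum
  have hspace : ∀ i, dirD (spaceDir n i) (fun x => ζ x ^ 2 * G x) z = 0 ∧
      dirD (spaceDir n i) (dirD (spaceDir n i) (fun x => ζ x ^ 2 * G x)) z ≤ 0 := by
    intro i
    refine dirD_of_line_max hΩ hN hzΩ _ ?_
    have hc : Continuous fun r : ℝ =>
        Real.log (1 + ‖(z + r • spaceDir n i).2‖ ^ 2) :=
      (contDiff_log_weight n).continuous.comp (by fun_prop)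
    have hev : ∀ᶠ r : ℝ in nhds 0, Real.log (1 + ‖(z + r • spaceDir n i).2‖ ^ 2) < R :=
      hc.continuousAt.eventually (gt_mem_nhds (by simpa using hlt))
    filter_upwards [hev] with r hr
    have h1 : (z + r • spaceDir n i).1 = z.1 := by simp [spaceDir]
    have h2 : z + r • spaceDir n i ∈ S := ⟨h1 ▸ hzS.1, hr.le⟩
    have h3 : M (z + r • spaceDir n i) ≤ M z := hzmax h2
    simp only [hM, h1] at h3
    exact le_of_mul_le_mul_left h3 hθ
  have hζd : ∀ x ∈ positiveTime n, DifferentiableAt ℝ ζ x := fun x hx => hζ.diffAt_of_isOpen hΩ hx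
  have hGd : ∀ x ∈ positiveTime n, DifferentiableAt ℝ G x := fun x hx => hG.diffAt_of_isOpen hΩ hx
  have hD1 : ∀ i, ∀ x ∈ positiveTime n, dirD (spaceDir n i) (fun x => ζ x ^ 2 * G x) x =
      ζ x ^ 2 * dirD (spaceDir n i) G x + 2 * ζ x * dirD (spaceDir n i) ζ x * G x := by
    intro i x hx
    have := hζd x hx
    rw [dirD_mul _ (by fun_prop) (hGd x hx), dirD_sq _ this]
  have hD2 : ∀ i, dirD (spaceDir n i) (dirD (spaceDir n i) (fun x => ζ x ^ 2 * G x)) z =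
      (2 * dirD (spaceDir n i) ζ z ^ 2
        + 2 * ζ z * dirD (spaceDir n i) (dirD (spaceDir n i) ζ) z) * G z
      + 4 * ζ z * dirD (spaceDir n i) ζ z * dirD (spaceDir n i) G z
      + ζ z ^ 2 * dirD (spaceDir n i) (dirD (spaceDir n i) G) z := by
    intro i
    have d1 := hζd z hzΩ
    have d2 := hGd z hzΩ
    have d3 := (hζ.dirD hΩ (spaceDir n i)).diffAt_of_isOpen hΩ hzΩ
    have d4 := (hG.dirD hΩ (spaceDir n i)).diffAt_of_isOpen hΩ hzΩ
    rw [dirD_congr hΩ (hD1 i) _ hzΩ, dirD_add _ (by fun_prop) (by fun_prop),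
      dirD_mul _ (by fun_prop) d4, dirD_mul _ (by fun_prop) d2, dirD_mul _ (by fun_prop) d3,
      dirD_mul _ (by fun_prop) d1, dirD_sq _ d1]
    have : dirD (spaceDir n i) (fun _ : ℝ × EuclideanSpace ℝ (Fin n) => (2 : ℝ)) z = 0 := by
      simp [dirD]
    rw [this]
    ring
  -- time condition at the maximum
  have htime : 0 ≤ (1 / (z.1 - s) - 4 * K) * G z + dirD (timeDir n) G z := by
    have hd : HasDerivAt (fun r : ℝ => G (r, z.2)) (dirD (timeDir n) G z) z.1 := by
      have hc : HasDerivAt (fun r : ℝ => (r, z.2)) (timeDir n) z.1 :=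
        (hasDerivAt_id z.1).prodMk (hasDerivAt_const _ _)
      exact (hGd z hzΩ).hasFDerivAt.comp_hasDerivAt z.1 hc
    refine time_deriv_nonneg_of_max (g := fun r => G (r, z.2)) (by linarith) hd fun r hr => ?_
    have hrS : ((r, z.2) : ℝ × EuclideanSpace ℝ (Fin n)) ∈ S :=
      ⟨⟨hr.1, hr.2.trans hzS.1.2⟩, hzS.2⟩
    have h3 : M (r, z.2) ≤ M z := hzmax hrS
    have h4 : ζ (r, z.2) = ζ z := by rw [hζeq, hζeq]
    simp only [hM, h4] at h3
    refine le_of_mul_le_mul_left (a := ζ z ^ 2) ?_ (by positivity)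
    calc _ = _ := by ring
      _ ≤ _ := h3
      _ = _ := by ring
  have hα : 1 < a * Real.exp (2 * K * z.1) := by
    have : 1 ≤ Real.exp (2 * K * z.1) :=
      Real.one_le_exp (mul_nonneg (by linarith) (le_of_lt hzΩ))
    nlinarith
  have key := max_point_estimate (α := a * Real.exp (2 * K * z.1)) hζz0 hζz1 hGz hm0 hα hK hsz
    (C := (2 * n + 2 * C) / R) (by positivity) rfl rfl
    (fun i => by rw [← (hspace i).1, hD1 i z hzΩ]; ring)
    (fun i => by have := (hspace i).2; rwa [hD2 i] at this) htime (h.evolution_le hn hm a hzΩ)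
    (neg_sum_logCutoff_le hR z (hgr z hzΩ)) (sum_sq_dirD_logCutoff_le hR z)
  set E := Real.exp (2 * K * z.1) with hE
  have hE0 : 0 < E := Real.exp_pos _
  have hE1 : 1 ≤ E := Real.one_le_exp (mul_nonneg (by linarith) (le_of_lt hzΩ))
  have hET : E ≤ Real.exp (2 * K * T) := by
    rw [hE]; gcongr; exact hzS.1.2
  have hexp : Real.exp (-4 * K * z.1) = 1 / E ^ 2 := by
    rw [hE, ← Real.exp_nat_mul, one_div, ← Real.exp_neg]; congr 1; push_cast; ring
  have hlast : m * (a * E) ^ 2 / (a * E - 1) ≤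
      m * (a * Real.exp (2 * K * T)) ^ 2 / (a - 1) := by
    gcongr
    nlinarith
  have key2 : 2 / (m * (a * E) ^ 2) * (ζ z ^ 2 * G z) ≤ 1 / (z.1 - s) +
      (6 + 2 * (2 * n + 2 * C) + m * (a * Real.exp (2 * K * T)) ^ 2 / (a - 1)) / R := by
    refine key.trans ?_
    have : m * (a * E) ^ 2 / (a * E - 1) * (1 / R) ≤
      m * (a * Real.exp (2 * K * T)) ^ 2 / (a - 1) * (1 / R) := by gcongr
    refine (add_le_add_right this _).trans (le_of_eq ?_)
    ring
  set B := 6 + 2 * (2 * n + 2 * C) + m * (a * Real.exp (2 * K * T)) ^ 2 / (a - 1) with hB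
  have hB0 : 0 ≤ B := by positivity
  have e1 : M z = m * a ^ 2 / 2 * ((z.1 - s) * (2 / (m * (a * E) ^ 2) * (ζ z ^ 2 * G z))) := by
    simp only [hM, hexp]; field_simp
  rw [e1]
  have e2 : (z.1 - s) * (1 / (z.1 - s) + B / R) ≤ 1 + T * B / R := by
    have : (z.1 - s) * (B / R) ≤ T * (B / R) := by
      gcongr
      linarith [hzS.1.2]
    have h1 : (z.1 - s) * (1 / (z.1 - s)) = 1 := by field_simp
    rw [mul_add, h1, mul_div_assoc]
    linarith
  have e3 := mul_le_mul_of_nonneg_left key2 hsz.le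
  have : 0 ≤ m * a ^ 2 / 2 := by positivity
  exact mul_le_mul_of_nonneg_left (e3.trans e2) this


/-- **Hamilton's differential Harnack inequality**. -/
lemma IsLogHeat.hamilton (h : IsLogHeat n m K Φ f) (hn : 1 ≤ n) (hm : (n : ℝ) < m)
    (hK : 0 ≤ K) {C : ℝ} (hC : 0 ≤ C)
    (hgr : ∀ p ∈ positiveTime n, -∑ i, dirD (spaceDir n i) Φ p * p.2 i ≤ C * (1 + ‖p.2‖ ^ 2))
    {p : ℝ × EuclideanSpace ℝ (Fin n)} (hp : p ∈ positiveTime n) :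
    p.1 * Real.exp (-4 * K * p.1) * ((∑ j, dirD (spaceDir n j) f p ^ 2)
      - Real.exp (2 * K * p.1) * dirD (timeDir n) f p) ≤ m / 2 := by
  have hpt : 0 < p.1 := hp
  have hlim : ∀ s ∈ Set.Ioo 0 p.1, (p.1 - s) * Real.exp (-4 * K * p.1) *
      hamiltonQuantity n K (1 + s) f p ≤ m * (1 + s) ^ 2 / 2 := by
    intro s hs
    set B := p.1 * (6 + 2 * (2 * n + 2 * C)
      + m * ((1 + s) * Real.exp (2 * K * p.1)) ^ 2 / (1 + s - 1)) with hB
    have hinv : Filter.Tendsto (fun R : ℝ => R⁻¹) Filter.atTop (nhds 0) := tendsto_inv_atTop_zero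
    have hcut : Filter.Tendsto (fun R => logCutoff n R p) Filter.atTop (nhds 1) := by
      have := (hinv.neg.mul_const (Real.log (1 + ‖p.2‖ ^ 2))).const_add 1
      simpa [logCutoff, neg_div] using this
    have hl : Filter.Tendsto (fun R => (p.1 - s) * Real.exp (-4 * K * p.1) *
        (logCutoff n R p ^ 2 * hamiltonQuantity n K (1 + s) f p)) Filter.atTop
        (nhds ((p.1 - s) * Real.exp (-4 * K * p.1) *
          (1 ^ 2 * hamiltonQuantity n K (1 + s) f p))) :=
      ((hcut.pow 2).mul_const _).const_mul _
    have hr : Filter.Tendsto (fun R : ℝ => m * (1 + s) ^ 2 / 2 * (1 + B * R⁻¹)) Filter.atTop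
        (nhds (m * (1 + s) ^ 2 / 2 * (1 + B * 0))) :=
      ((hinv.const_mul B).const_add 1).const_mul _
    have hle := le_of_tendsto_of_tendsto hl hr (by
      filter_upwards [Filter.eventually_ge_atTop (1 : ℝ),
        Filter.eventually_ge_atTop (Real.log (1 + ‖p.2‖ ^ 2))] with R h1 h2
      rw [hB, ← div_eq_mul_inv]
      exact h.hamilton_local hn hm hK hC hgr (by linarith [hs.1]) hs.1 h1 ⟨hs.2.le, le_rfl⟩ h2)
    simpa using hle
  have hl : Filter.Tendsto (fun s => (p.1 - s) * Real.exp (-4 * K * p.1) *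
      hamiltonQuantity n K (1 + s) f p) (nhdsWithin 0 (Set.Ioi 0))
      (nhds ((p.1 - 0) * Real.exp (-4 * K * p.1) * hamiltonQuantity n K (1 + 0) f p)) := by
    unfold hamiltonQuantity
    exact (Continuous.tendsto (by fun_prop) 0).mono_left nhdsWithin_le_nhds
  have hr : Filter.Tendsto (fun s : ℝ => m * (1 + s) ^ 2 / 2) (nhdsWithin 0 (Set.Ioi 0))
      (nhds (m * (1 + 0) ^ 2 / 2)) :=
    (Continuous.tendsto (by fun_prop) 0).mono_left nhdsWithin_le_nhds
  have := le_of_tendsto_of_tendsto hl hr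
    (Filter.mem_of_superset (Ioo_mem_nhdsGT hpt) hlim)
  simpa [hamiltonQuantity] using this

end Hamilton

section Integration

lemma EuclideanSpace.eq_sum_smul_single {n : ℕ} (v : EuclideanSpace ℝ (Fin n)) :
    v = ∑ i, v i • EuclideanSpace.single i (1 : ℝ) := by
  ext j
  simp [Finset.sum_apply, Pi.single_apply]

lemma fderiv_prod_eq_sum {n : ℕ} (f : ℝ × EuclideanSpace ℝ (Fin n) → ℝ)
    (p : ℝ × EuclideanSpace ℝ (Fin n)) (r : ℝ) (v : EuclideanSpace ℝ (Fin n)) :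
    fderiv ℝ f p (r, v) = r * dirD (timeDir n) f p + ∑ i, v i * dirD (spaceDir n i) f p := by
  have h : ((r, v) : ℝ × EuclideanSpace ℝ (Fin n)) =
      r • timeDir n + ∑ i, v i • spaceDir n i := by
    refine Prod.ext ?_ ?_
    · simp [timeDir, spaceDir, Prod.fst_sum]
    · conv_lhs => rw [EuclideanSpace.eq_sum_smul_single v]
      simp [timeDir, spaceDir, Prod.snd_sum]
  rw [h, map_add, map_smul, map_sum]
  simp [dirD]

/-- An antiderivative of `e^{-2Kt}`, with the lower bound on its increments needed below. -/
lemma exists_antideriv_exp {K : ℝ} (hK : 0 ≤ K) : ∃ S : ℝ → ℝ,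
    (∀ t, HasDerivAt S (Real.exp (-(2 * K * t))) t) ∧ ∀ τ T, τ < T →
      (T - τ) ≤ Real.exp (2 * K * τ) * (1 + 2 * K * (T - τ)) * (S T - S τ) := by
  rcases hK.eq_or_lt with rfl | hK
  · refine ⟨fun t => t, fun t => (hasDerivAt_id' t).congr_deriv (by simp), fun τ T _ => by simp⟩
  · refine ⟨fun t => -Real.exp (-(2 * K * t)) / (2 * K), fun t => ?_, fun τ T hτT => ?_⟩
    · have := (((hasDerivAt_id t).const_mul (2 * K)).neg.exp.neg).div_const (2 * K)
      refine this.congr_deriv ?_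
      simp
      field_simp
    · set δ := T - τ with hδ
      have hδ0 : 0 < δ := by rw [hδ]; linarith
      have e1 : Real.exp (-(2 * K * T)) = Real.exp (-(2 * K * τ)) * Real.exp (-(2 * K * δ)) := by
        rw [← Real.exp_add]; congr 1; rw [hδ]; ring
      have e2 : Real.exp (2 * K * τ) * Real.exp (-(2 * K * τ)) = 1 := by
        rw [← Real.exp_add]; simp
      have e3 : Real.exp (2 * K * τ) * (1 + 2 * K * δ) * (-Real.exp (-(2 * K * T)) / (2 * K)
          - -Real.exp (-(2 * K * τ)) / (2 * K)) =
          (1 + 2 * K * δ) * (1 - Real.exp (-(2 * K * δ))) / (2 * K) := by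
        rw [e1]
        linear_combination
          ((1 + 2 * K * δ) * (1 - Real.exp (-(2 * K * δ))) / (2 * K)) * e2
      rw [e3, le_div_iff₀ (by positivity)]
      have h1 : (1 + 2 * K * δ) * Real.exp (-(2 * K * δ)) ≤ 1 := by
        have := Real.add_one_le_exp (2 * K * δ)
        calc _ ≤ Real.exp (2 * K * δ) * Real.exp (-(2 * K * δ)) := by gcongr; linarith
          _ = 1 := by rw [← Real.exp_add]; simp
      linarith

/-- Integration of Hamilton's inequality along a space-time curve. -/
lemma log_harnack_of_hamilton {n : ℕ} {m K : ℝ} (hm : 0 < m) (hK : 0 ≤ K)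
    {f : ℝ × EuclideanSpace ℝ (Fin n) → ℝ}
    (hf : ∀ p ∈ positiveTime n, DifferentiableAt ℝ f p)
    (hH : ∀ p ∈ positiveTime n,
      p.1 * Real.exp (-4 * K * p.1) * ((∑ j, dirD (spaceDir n j) f p ^ 2)
        - Real.exp (2 * K * p.1) * dirD (timeDir n) f p) ≤ m / 2)
    (x y : EuclideanSpace ℝ (Fin n)) {τ T : ℝ} (hτ : 0 < τ) (hτT : τ < T) :
    f (τ, x) - f (T, y) ≤ m / 2 * Real.log (T / τ)
      + (1 / 4 * Real.exp (2 * K * τ) * (1 + 2 * K * (T - τ)) * ‖x - y‖ ^ 2 / (T - τ)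
        + m / 2 * (Real.exp (2 * K * T) - Real.exp (2 * K * τ))) := by
  obtain ⟨S, hS, hSJ⟩ := exists_antideriv_exp hK
  have hδ : 0 < T - τ := by linarith
  have hJ := hSJ τ T hτT
  have hA : 0 < Real.exp (2 * K * τ) * (1 + 2 * K * (T - τ)) := by positivity
  set J := S T - S τ with hJdef
  have hJ0 : 0 < J := pos_of_mul_pos_right (hδ.trans_le hJ) hA.le
  set d := y - x with hd
  set γ : ℝ → ℝ × EuclideanSpace ℝ (Fin n) := fun t => (t, x + ((S t - S τ) / J) • d) with hγ
  have hγd : ∀ t, HasDerivAt γ (1, (Real.exp (-(2 * K * t)) / J) • d) t := fun t =>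
    (hasDerivAt_id t).prodMk
      (((((hS t).sub_const (S τ)).div_const J).smul_const d).const_add x)
  set ψ : ℝ → ℝ := fun t => f (γ t) + ‖d‖ ^ 2 / (4 * J ^ 2) * S t
    + m / 2 * (Real.log t + Real.exp (2 * K * t)) with hψ
  have hψd : ∀ t, 0 < t → HasDerivAt ψ
      (dirD (timeDir n) f (γ t)
        + (∑ i, Real.exp (-(2 * K * t)) / J * d i * dirD (spaceDir n i) f (γ t))
        + ‖d‖ ^ 2 / (4 * J ^ 2) * Real.exp (-(2 * K * t))
        + m / 2 * (1 / t + 2 * K * Real.exp (2 * K * t))) t := by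
    intro t ht
    have h1 := (hf (γ t) ht).hasFDerivAt.comp_hasDerivAt t (hγd t)
    rw [fderiv_prod_eq_sum] at h1
    have h2 := (hS t).const_mul (‖d‖ ^ 2 / (4 * J ^ 2))
    have h3 := ((Real.hasDerivAt_log ht.ne').add
      (((hasDerivAt_id t).const_mul (2 * K)).exp)).const_mul (m / 2)
    refine ((h1.add h2).add h3).congr_deriv ?_
    simp only [PiLp.smul_apply, smul_eq_mul, one_mul, mul_one, id_eq, one_div]
    ring
  have hψ0 : ∀ t, 0 < t → 0 ≤ dirD (timeDir n) f (γ t)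
        + (∑ i, Real.exp (-(2 * K * t)) / J * d i * dirD (spaceDir n i) f (γ t))
        + ‖d‖ ^ 2 / (4 * J ^ 2) * Real.exp (-(2 * K * t))
        + m / 2 * (1 / t + 2 * K * Real.exp (2 * K * t)) := by
    intro t ht
    have hh := hH (γ t) ht
    change t * Real.exp (-4 * K * t) * ((∑ j, dirD (spaceDir n j) f (γ t) ^ 2)
        - Real.exp (2 * K * t) * dirD (timeDir n) f (γ t)) ≤ m / 2 at hh
    set E := Real.exp (2 * K * t) with hE
    have hE0 : 0 < E := Real.exp_pos _
    have hE4 : Real.exp (-4 * K * t) = 1 / E ^ 2 := by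
      rw [hE, ← Real.exp_nat_mul, one_div, ← Real.exp_neg]; congr 1; push_cast; ring
    have hE2 : Real.exp (-(2 * K * t)) = 1 / E := by rw [Real.exp_neg, one_div]
    rw [hE4] at hh
    rw [hE2]
    set P := dirD (timeDir n) f (γ t)
    set g : Fin n → ℝ := fun i => dirD (spaceDir n i) f (γ t)
    change t * (1 / E ^ 2) * ((∑ j, g j ^ 2) - E * P) ≤ m / 2 at hh
    have hP : (∑ j, g j ^ 2) / E - m / 2 * (E / t) ≤ P := by
      have : (t * (1 / E ^ 2) * ((∑ j, g j ^ 2) - E * P)) * (E / t) ≤ m / 2 * (E / t) := by gcongr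
      have e : (t * (1 / E ^ 2) * ((∑ j, g j ^ 2) - E * P)) * (E / t) =
          (∑ j, g j ^ 2) / E - P := by field_simp
      linarith
    have hEt : E / t ≤ 1 / t + 2 * K * E := by
      have h1 : 1 - 2 * K * t ≤ 1 / E := by
        rw [← hE2]; linarith [Real.add_one_le_exp (-(2 * K * t))]
      have h2 : (1 - 2 * K * t) * E ≤ 1 := by rwa [le_div_iff₀ hE0] at h1
      have e : 1 / t + 2 * K * E - E / t = (1 - (1 - 2 * K * t) * E) / t := by field_simp; ring
      have : 0 ≤ (1 - (1 - 2 * K * t) * E) / t := div_nonneg (by linarith) ht.le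
      linarith
    have hsq : 0 ≤ (∑ j, g j ^ 2) / E + (∑ i, 1 / E / J * d i * g i)
        + ‖d‖ ^ 2 / (4 * J ^ 2) * (1 / E) := by
      rw [EuclideanSpace.real_norm_sq_eq]
      have e : (∑ j, g j ^ 2) / E + (∑ i, 1 / E / J * d i * g i)
          + (∑ i, d i ^ 2) / (4 * J ^ 2) * (1 / E) =
          ∑ i, (g i + d i / (2 * J)) ^ 2 / E := by
        rw [Finset.sum_div, Finset.sum_div, Finset.sum_mul, ← Finset.sum_add_distrib,
          ← Finset.sum_add_distrib]
        refine Finset.sum_congr rfl fun i _ => ?_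
        field_simp
        ring
      rw [e]
      exact Finset.sum_nonneg fun i _ => by positivity
    have hmE := mul_le_mul_of_nonneg_left hEt (by positivity : 0 ≤ m / 2)
    linarith
  have hmono : MonotoneOn ψ (Set.Icc τ T) := by
    refine monotoneOn_of_deriv_nonneg (convex_Icc τ T)
      (fun t ht => (hψd t (hτ.trans_le ht.1)).continuousAt.continuousWithinAt)
      (fun t ht => ?_) fun t ht => ?_
    · rw [interior_Icc] at ht
      exact (hψd t (hτ.trans ht.1)).differentiableAt.differentiableWithinAt
    · rw [interior_Icc] at ht
      rw [(hψd t (hτ.trans ht.1)).deriv]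
      exact hψ0 t (hτ.trans ht.1)
  have hle := hmono (Set.left_mem_Icc.2 hτT.le) (Set.right_mem_Icc.2 hτT.le) hτT.le
  have hγτ : γ τ = (τ, x) := by simp [hγ]
  have hγT : γ T = (T, y) := by simp [hγ, ← hJdef, div_self hJ0.ne', hd]
  simp only [hψ, hγτ, hγT] at hle
  have hdist : ‖d‖ ^ 2 / (4 * J ^ 2) * J ≤
      1 / 4 * Real.exp (2 * K * τ) * (1 + 2 * K * (T - τ)) * ‖x - y‖ ^ 2 / (T - τ) := by
    rw [hd, norm_sub_rev, le_div_iff₀ hδ]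
    have e : ‖x - y‖ ^ 2 / (4 * J ^ 2) * J * (T - τ) = ‖x - y‖ ^ 2 / (4 * J) * (T - τ) := by
      field_simp
    rw [e]
    calc _ ≤ ‖x - y‖ ^ 2 / (4 * J) *
        (Real.exp (2 * K * τ) * (1 + 2 * K * (T - τ)) * J) := by gcongr
      _ = _ := by field_simp
  rw [Real.log_div (hτ.trans hτT).ne' hτ.ne']
  have e2 : ‖d‖ ^ 2 / (4 * J ^ 2) * J =
      ‖d‖ ^ 2 / (4 * J ^ 2) * S T - ‖d‖ ^ 2 / (4 * J ^ 2) * S τ := by rw [hJdef]; ring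
  linarith

end Integration

section Euclidean

variable {n : ℕ}

lemma dirD_spaceDir_eq_fderiv_slice {F : ℝ × EuclideanSpace ℝ (Fin n) → ℝ}
    {p : ℝ × EuclideanSpace ℝ (Fin n)} (hF : DifferentiableAt ℝ F p) (i : Fin n) :
    dirD (spaceDir n i) F p = fderiv ℝ (fun y => F (p.1, y)) p.2 (EuclideanSpace.single i 1) := by
  have h1 : HasFDerivAt (fun y : EuclideanSpace ℝ (Fin n) => (p.1, y))
      (ContinuousLinearMap.inr ℝ ℝ (EuclideanSpace ℝ (Fin n))) p.2 := hasFDerivAt_prodMk_right _ _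
  have h2 : HasFDerivAt (fun y => F (p.1, y))
      ((fderiv ℝ F p).comp (ContinuousLinearMap.inr ℝ ℝ (EuclideanSpace ℝ (Fin n)))) p.2 :=
    HasFDerivAt.comp p.2 (f := fun y => (p.1, y)) (by exact hF.hasFDerivAt) h1
  rw [h2.fderiv]
  simp [dirD, spaceDir]

lemma dirD_timeDir_eq_deriv {F : ℝ × EuclideanSpace ℝ (Fin n) → ℝ}
    {p : ℝ × EuclideanSpace ℝ (Fin n)} (hF : DifferentiableAt ℝ F p) :
    dirD (timeDir n) F p = deriv (fun s => F (s, p.2)) p.1 := by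
  have hc : HasDerivAt (fun r : ℝ => (r, p.2)) (timeDir n) p.1 :=
    (hasDerivAt_id p.1).prodMk (hasDerivAt_const _ _)
  have h2 : HasDerivAt (fun s => F (s, p.2)) (dirD (timeDir n) F p) p.1 :=
    HasFDerivAt.comp_hasDerivAt p.1 (f := fun s => (s, p.2)) (by exact hF.hasFDerivAt) hc
  exact h2.deriv.symm

lemma hess_slice_single {F : ℝ × EuclideanSpace ℝ (Fin n) → ℝ}
    (hF : ContDiffOn ℝ (⊤ : ℕ∞) F (positiveTime n)) {p : ℝ × EuclideanSpace ℝ (Fin n)}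
    (hp : p ∈ positiveTime n) (i j : Fin n) :
    hess n (fun y => F (p.1, y)) p.2 (EuclideanSpace.single i 1) (EuclideanSpace.single j 1) =
      dirD (spaceDir n j) (dirD (spaceDir n i) F) p := by
  have hΩ := isOpen_positiveTime n
  rw [dirD_spaceDir_eq_fderiv_slice ((hF.dirD hΩ _).diffAt_of_isOpen hΩ hp), hess]
  congr 2
  ext y
  exact (dirD_spaceDir_eq_fderiv_slice (p := (p.1, y))
    (hF.diffAt_of_isOpen hΩ (show (p.1, y) ∈ positiveTime n from hp)) i).symm

lemma fderiv_eq_sum_single (g : EuclideanSpace ℝ (Fin n) → ℝ) (x v : EuclideanSpace ℝ (Fin n)) :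
    fderiv ℝ g x v = ∑ i, fderiv ℝ g x (EuclideanSpace.single i 1) * v i := by
  conv_lhs => rw [EuclideanSpace.eq_sum_smul_single v, map_sum]
  simp [mul_comm]

lemma inner_gradient_eq_fderiv {g : EuclideanSpace ℝ (Fin n) → ℝ}
    (x v : EuclideanSpace ℝ (Fin n)) : ⟪gradient g x, v⟫ = fderiv ℝ g x v := by
  simp [gradient]

lemma hess_eq_fderiv_fderiv {g : EuclideanSpace ℝ (Fin n) → ℝ} (hg : ContDiff ℝ (⊤ : ℕ∞) g)
    (x v w : EuclideanSpace ℝ (Fin n)) : hess n g x v w = fderiv ℝ (fderiv ℝ g) x w v := by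
  have hd : DifferentiableAt ℝ (fderiv ℝ g) x :=
    (hg.fderiv_right (m := (⊤ : ℕ∞)) (by simp)).differentiable (by simp) x
  rw [hess, fderiv_clm_apply hd (by fun_prop)]
  simp

lemma hess_eq_sum_single {g : EuclideanSpace ℝ (Fin n) → ℝ} (hg : ContDiff ℝ (⊤ : ℕ∞) g)
    (x v : EuclideanSpace ℝ (Fin n)) :
    hess n g x v v = ∑ i, ∑ j, hess n g x (EuclideanSpace.single i 1)
      (EuclideanSpace.single j 1) * v i * v j := by
  simp only [hess_eq_fderiv_fderiv hg]
  conv_lhs => rw [EuclideanSpace.eq_sum_smul_single v]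
  simp only [map_sum, map_smul, _root_.sum_apply, _root_.smul_apply,
    smul_eq_mul, Finset.mul_sum]
  refine Finset.sum_congr rfl fun i _ => Finset.sum_congr rfl fun j _ => ?_
  ring

/-- A lower Hessian bound controls the radial derivative from below. -/
lemma neg_fderiv_self_le {g : EuclideanSpace ℝ (Fin n) → ℝ} (hg : ContDiff ℝ (⊤ : ℕ∞) g) {K : ℝ}
    (hK : 0 ≤ K) (hess_ge : ∀ x v, -K * ‖v‖ ^ 2 ≤ hess n g x v v)
    (x : EuclideanSpace ℝ (Fin n)) :
    -fderiv ℝ g x x ≤ (‖fderiv ℝ g 0‖ + K) * (1 + ‖x‖ ^ 2) := by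
  have hd : Differentiable ℝ (fderiv ℝ g) :=
    (hg.fderiv_right (m := (⊤ : ℕ∞)) (by simp)).differentiable (by simp)
  have hder : ∀ r : ℝ, HasDerivAt (fun r : ℝ => fderiv ℝ g (r • x) x + K * ‖x‖ ^ 2 * r)
      (hess n g (r • x) x x + K * ‖x‖ ^ 2) r := by
    intro r
    have h1 : HasDerivAt (fun r : ℝ => r • x) x r := by
      simpa using (hasDerivAt_id r).smul_const x
    have h2 : HasDerivAt (fun r : ℝ => fderiv ℝ g (r • x)) (fderiv ℝ (fderiv ℝ g) (r • x) x) r :=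
      HasFDerivAt.comp_hasDerivAt r (f := fun r : ℝ => r • x) (hd (r • x)).hasFDerivAt h1
    have h3 : HasDerivAt (fun r : ℝ => fderiv ℝ g (r • x) x)
        (fderiv ℝ (fderiv ℝ g) (r • x) x x) r := by
      simpa using h2.clm_apply (hasDerivAt_const r x)
    have h4 : HasDerivAt (fun r : ℝ => K * ‖x‖ ^ 2 * r) (K * ‖x‖ ^ 2) r := by
      simpa using (hasDerivAt_id' r).const_mul (K * ‖x‖ ^ 2)
    rw [hess_eq_fderiv_fderiv hg]
    exact h3.add h4
  have hmono : Monotone (fun r : ℝ => fderiv ℝ g (r • x) x + K * ‖x‖ ^ 2 * r) := by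
    refine monotone_of_deriv_nonneg (fun r => (hder r).differentiableAt) fun r => ?_
    rw [(hder r).deriv]
    linarith [hess_ge (r • x) x]
  have h01 := hmono (zero_le_one' ℝ)
  simp only [zero_smul, mul_zero, add_zero, one_smul, mul_one] at h01
  have h0 : -(fderiv ℝ g 0 x) ≤ ‖fderiv ℝ g 0‖ * ‖x‖ :=
    (neg_le_abs _).trans ((fderiv ℝ g 0).le_opNorm x)
  have h1 : ‖fderiv ℝ g 0‖ * ‖x‖ ≤ ‖fderiv ℝ g 0‖ * (1 + ‖x‖ ^ 2) := by
    gcongr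
    nlinarith [sq_nonneg (‖x‖ - 1)]
  nlinarith

lemma dirD_log {V : Type*} [NormedAddCommGroup V] [NormedSpace ℝ V] {F : V → ℝ} {p : V} (v : V)
    (hF : DifferentiableAt ℝ F p) (h0 : F p ≠ 0) :
    dirD v (fun x => Real.log (F x)) p = (F p)⁻¹ * dirD v F p := by
  simp [dirD, fderiv.log hF h0]

lemma dirD_inv {V : Type*} [NormedAddCommGroup V] [NormedSpace ℝ V] {F : V → ℝ} {p : V} (v : V)
    (hF : DifferentiableAt ℝ F p) (h0 : F p ≠ 0) :
    dirD v (fun x => (F x)⁻¹) p = -dirD v F p / F p ^ 2 := by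
  have h := (hasDerivAt_inv h0).comp_hasFDerivAt p hF.hasFDerivAt
  have h' : fderiv ℝ (fun x => (F x)⁻¹) p = _ := h.fderiv
  simp [dirD, h']
  ring

/-- The logarithm of a positive solution of the Witten heat equation. -/
lemma isLogHeat_log {m K : ℝ} {φ : EuclideanSpace ℝ (Fin n) → ℝ} (hφ : ContDiff ℝ (⊤ : ℕ∞) φ)
    (hCD : CDcond n φ m K) {u : ℝ → EuclideanSpace ℝ (Fin n) → ℝ}
    (hu : ContDiffOn ℝ (⊤ : ℕ∞) (fun p : ℝ × EuclideanSpace ℝ (Fin n) => u p.1 p.2)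
      (positiveTime n))
    (hpos : ∀ t > (0 : ℝ), ∀ x, 0 < u t x)
    (hheat : ∀ t > (0 : ℝ), ∀ x, deriv (fun s => u s x) t = witten n φ (u t) x) :
    IsLogHeat n m K (fun p => φ p.2) (fun p => Real.log (u p.1 p.2)) := by
  have hΩ := isOpen_positiveTime n
  have hΦ : ContDiff ℝ (⊤ : ℕ∞) (fun p : ℝ × EuclideanSpace ℝ (Fin n) => φ p.2) :=
    hφ.comp contDiff_snd
  have hΦi : ∀ (p : ℝ × EuclideanSpace ℝ (Fin n)) i, dirD (spaceDir n i) (fun p => φ p.2) p =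
      fderiv ℝ φ p.2 (EuclideanSpace.single i 1) := fun p i =>
    dirD_spaceDir_eq_fderiv_slice (hΦ.differentiable (by simp) p) i
  have hne : ∀ p ∈ positiveTime n, u p.1 p.2 ≠ 0 := fun p hp => (hpos _ hp _).ne'
  refine ⟨hu.log hne, hΦ.contDiffOn, fun p hp => ?_, fun p hp => ?_, fun p hp v => ?_⟩
  · rw [dirD_timeDir_eq_deriv (hΦ.differentiable (by simp) p)]
    simp
  · have hU := hu.diffAt_of_isOpen hΩ hp
    have hlog : ∀ v, ∀ x ∈ positiveTime n, dirD v (fun p => Real.log (u p.1 p.2)) x =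
        (u x.1 x.2)⁻¹ * dirD v (fun p => u p.1 p.2) x := fun v x hx =>
      dirD_log v (hu.diffAt_of_isOpen hΩ hx) (hne x hx)
    have hlog2 : ∀ i, dirD (spaceDir n i) (dirD (spaceDir n i) (fun p => Real.log (u p.1 p.2))) p =
        (u p.1 p.2)⁻¹ * dirD (spaceDir n i) (dirD (spaceDir n i) (fun p => u p.1 p.2)) p
          - ((u p.1 p.2)⁻¹ * dirD (spaceDir n i) (fun p => u p.1 p.2) p) ^ 2 := by
      intro i
      rw [dirD_congr hΩ (hlog _) _ hp, dirD_mul _ (hU.fun_inv (hne p hp))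
        ((hu.dirD hΩ _).diffAt_of_isOpen hΩ hp), dirD_inv _ hU (hne p hp)]
      field_simp
      ring
    have hheat' : dirD (timeDir n) (fun p => u p.1 p.2) p =
        ∑ i, (dirD (spaceDir n i) (dirD (spaceDir n i) (fun p => u p.1 p.2)) p
          - dirD (spaceDir n i) (fun p => φ p.2) p *
            dirD (spaceDir n i) (fun p => u p.1 p.2) p) := by
      rw [dirD_timeDir_eq_deriv hU, hheat p.1 hp p.2, witten, lap, Finset.sum_sub_distrib]
      congr 1
      · exact Finset.sum_congr rfl fun i _ => hess_slice_single hu hp i i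
      · rw [real_inner_comm, inner_gradient_eq_fderiv, fderiv_eq_sum_single]
        refine Finset.sum_congr rfl fun i _ => ?_
        rw [dirD_spaceDir_eq_fderiv_slice hU, hΦi, mul_comm, ← inner_gradient_eq_fderiv (g := φ),
          EuclideanSpace.inner_single_right]
        simp
    rw [hlog _ p hp, hheat', Finset.mul_sum]
    refine Finset.sum_congr rfl fun i _ => ?_
    rw [hlog2, hlog _ p hp]
    ring
  · have h := hCD p.2 (WithLp.toLp 2 v)
    rw [inner_gradient_eq_fderiv, fderiv_eq_sum_single, hess_eq_sum_single hφ,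
      EuclideanSpace.real_norm_sq_eq] at h
    have h2 : ∀ i j, dirD (spaceDir n j) (dirD (spaceDir n i) (fun p => φ p.2)) p =
        hess n φ p.2 (EuclideanSpace.single i 1) (EuclideanSpace.single j 1) := fun i j =>
      (hess_slice_single hΦ.contDiffOn hp i j).symm
    simp only [hΦi, h2]
    linarith

end Euclidean

/-- **Integrated Harnack inequality** for the Witten Laplacian on `ℝⁿ`
under the `CD(−K, m)` condition (Euclidean case of Theorem 2.2). -/
theorem integrated_harnack_witten
    (n : ℕ) (hn : 1 ≤ n) (m K : ℝ) (hm : (n : ℝ) < m) (hK : 0 ≤ K)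
    (φ : EuclideanSpace ℝ (Fin n) → ℝ) (hφ : ContDiff ℝ (⊤ : ℕ∞) φ)
    (hCD : CDcond n φ m K)
    (u : ℝ → EuclideanSpace ℝ (Fin n) → ℝ)
    (hu : ContDiffOn ℝ (⊤ : ℕ∞) (fun p : ℝ × EuclideanSpace ℝ (Fin n) => u p.1 p.2)
      {p : ℝ × EuclideanSpace ℝ (Fin n) | 0 < p.1})
    (hpos : ∀ t > (0 : ℝ), ∀ x, 0 < u t x)
    (hheat : ∀ t > (0 : ℝ), ∀ x, deriv (fun s => u s x) t = witten n φ (u t) x) :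
    ∀ (x y : EuclideanSpace ℝ (Fin n)) (τ T : ℝ), 0 < τ → τ < T →
      u τ x / u T y
        ≤ (T / τ) ^ (m / 2) *
            Real.exp ((1 / 4) * Real.exp (2 * K * τ) * (1 + 2 * K * (T - τ)) *
                ‖x - y‖ ^ 2 / (T - τ)
              + (m / 2) * (Real.exp (2 * K * T) - Real.exp (2 * K * τ))) := by
  have hm0 : 0 < m := lt_of_le_of_lt (Nat.cast_nonneg n) hm
  have h := isLogHeat_log hφ hCD hu hpos hheat
  have hess_ge : ∀ x v, -K * ‖v‖ ^ 2 ≤ hess n φ x v v := fun x v => by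
    have h1 := hCD x v
    have h2 : 0 ≤ ⟪gradient φ x, v⟫ ^ 2 / (m - n) := div_nonneg (sq_nonneg _) (by linarith)
    linarith
  have hgr : ∀ p ∈ positiveTime n, -∑ i, dirD (spaceDir n i) (fun p => φ p.2) p * p.2 i ≤
      (‖fderiv ℝ φ 0‖ + K) * (1 + ‖p.2‖ ^ 2) := fun p _ => by
    refine le_trans (le_of_eq ?_) (neg_fderiv_self_le hφ hK hess_ge p.2)
    rw [fderiv_eq_sum_single]
    congr 1
    refine Finset.sum_congr rfl fun i _ => ?_
    rw [dirD_spaceDir_eq_fderiv_slice]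
    exact (hφ.differentiable (by simp) p.2).comp p differentiableAt_snd
  intro x y τ T hτ hτT
  have hT : 0 < T := hτ.trans hτT
  have hlog := log_harnack_of_hamilton hm0 hK
    (fun p hp => h.smooth.diffAt_of_isOpen (isOpen_positiveTime n) hp)
    (fun p hp => h.hamilton hn hm hK (by positivity) hgr hp) x y hτ hτT
  rw [Real.rpow_def_of_pos (by positivity), ← Real.exp_add,
    ← Real.log_le_iff_le_exp (div_pos (hpos τ hτ x) (hpos T hT y)),
    Real.log_div (hpos τ hτ x).ne' (hpos T hT y).ne', mul_comm (Real.log (T / τ))]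
  exact hlog
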